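/- Let α ∈ [1, 2] and β ∈ [0, 1]. The map F(L, R) = R^(β/2) · (R^(−β/2) L R^(−β/2))^α · R^(β/2) ⊗ (R^T)^((1−α)(1−β)), defined for L positive semidefinite and R positive definite complex n×n matrices (with ⊗ the Kronecker product and R^T the transpose), is jointly operator convex: for all λ ∈ [0,1], L₁, L₂ positive semidefinite, and R₁, R₂ positive definite, λ·F(L₁, R₁) + (1−λ)·F(L₂, R₂) − F(λL₁ + (1−λ)L₂, λR₁ + (1−λ)R₂) is positive semidefinite. -/

import Mathlib

open Matrix
open scoped Kronecker Classical ComplexOrder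

/-- Real power of a matrix via functional calculus on the eigenvalues of a Hermitian
matrix, with the convention that eigenvalue `0` is mapped to `0` (powers are taken on
the support). Non-Hermitian matrices are mapped to `0`. -/
noncomputable def matPow {n : Type*} [Fintype n] [DecidableEq n]
    (A : Matrix n n ℂ) (t : ℝ) : Matrix n n ℂ :=
  if hA : A.IsHermitian then
    (hA.eigenvectorUnitary : Matrix n n ℂ) *
      Matrix.diagonal (fun i =>
        ((if hA.eigenvalues i = 0 then (0 : ℝ) else hA.eigenvalues i ^ t : ℝ) : ℂ)) *
      (star (hA.eigenvectorUnitary : Matrix n n ℂ))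
  else 0

/-- `dominates σ ρ` (written `σ ≫ ρ` in the paper): the kernel of `σ` is contained in
the kernel of `ρ`. -/
def dominates {n : Type*} [Fintype n] (σ ρ : Matrix n n ℂ) : Prop :=
  ∀ v : n → ℂ, σ.mulVec v = 0 → ρ.mulVec v = 0

/-- The sandwiched Rényi divergence of order `α`, with values in `ℝ ∪ {+∞}` (as a
subset of `EReal`), logarithms base 2. It is `+∞` unless `ρ` is not orthogonal to `σ`
(i.e. `Tr[ρσ] ≠ 0`) and (`σ ≫ ρ` or `α < 1`). -/
noncomputable def Dtilde {n : Type*} [Fintype n] [DecidableEq n]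
    (α : ℝ) (ρ σ : Matrix n n ℂ) : EReal :=
  if (ρ * σ).trace ≠ 0 ∧ (dominates σ ρ ∨ α < 1) then
    (((α - 1)⁻¹ * Real.logb 2
        ((matPow (matPow σ ((1 - α) / (2 * α)) * ρ * matPow σ ((1 - α) / (2 * α))) α).trace.re
          / ρ.trace.re) : ℝ) : EReal)
  else ⊤

/-- The map `F(L, R) = R^(β/2) (R^(-β/2) L R^(-β/2))^α R^(β/2) ⊗ (R^T)^((1-α)(1-β))`. -/
noncomputable def Fmap {n : Type*} [Fintype n] [DecidableEq n]
    (α β : ℝ) (L R : Matrix n n ℂ) : Matrix (n × n) (n × n) ℂ :=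
  (matPow R (β / 2) * matPow (matPow R (-(β / 2)) * L * matPow R (-(β / 2))) α
      * matPow R (β / 2)) ⊗ₖ
    matPow Rᵀ ((1 - α) * (1 - β))

section MatPow

open scoped MatrixOrder

variable {m n : Type*} [Fintype m] [Fintype n]

lemma conjugate_le_conjugate {A B : Matrix m m ℂ} (h : A ≤ B) (V : Matrix m n ℂ) :
    Vᴴ * A * V ≤ Vᴴ * B * V := by
  rw [Matrix.le_iff] at h ⊢
  rw [← Matrix.sub_mul, ← Matrix.mul_sub]
  exact h.conjTranspose_mul_mul_same V

variable [DecidableEq m] [DecidableEq n]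

/-- The real power `x ^ t`, with `0` sent to `0` for every exponent. -/
noncomputable def suppPow (t x : ℝ) : ℝ := if x = 0 then 0 else x ^ t

lemma suppPow_nonneg {x : ℝ} (t : ℝ) (hx : 0 ≤ x) : 0 ≤ suppPow t x := by
  unfold suppPow
  split_ifs
  · exact le_rfl
  · positivity

lemma suppPow_one (x : ℝ) : suppPow 1 x = x := by
  unfold suppPow
  split_ifs with h <;> simp [h]

lemma suppPow_mul_suppPow {x : ℝ} (s t : ℝ) (hx : 0 ≤ x) :
    suppPow s x * suppPow t x = suppPow (s + t) x := by
  unfold suppPow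
  split_ifs with h
  · simp
  · rw [Real.rpow_add (lt_of_le_of_ne hx (Ne.symm h))]

lemma suppPow_suppPow {x : ℝ} (s t : ℝ) (hx : 0 ≤ x) :
    suppPow t (suppPow s x) = suppPow (s * t) x := by
  unfold suppPow
  by_cases h : x = 0
  · simp [h]
  · have : x ^ s ≠ 0 := (Real.rpow_pos_of_pos (lt_of_le_of_ne hx (Ne.symm h)) s).ne'
    simp [h, this, Real.rpow_mul hx]

lemma suppPow_mul {x y : ℝ} (t : ℝ) (hx : 0 ≤ x) (hy : 0 ≤ y) :
    suppPow t (x * y) = suppPow t x * suppPow t y := by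
  unfold suppPow
  by_cases h : x = 0
  · simp [h]
  · by_cases h' : y = 0
    · simp [h']
    · simp [h, h', Real.mul_rpow hx hy]

/-- The matrix with eigenvalues `d` and eigenvectors the columns of `U`. -/
noncomputable def spectralMatrix (U : Matrix n n ℂ) (d : n → ℝ) : Matrix n n ℂ :=
  U * diagonal (fun i => (d i : ℂ)) * Uᴴ

lemma spectralMatrix_mul_comm {U : Matrix m m ℂ} {W : Matrix n n ℂ}
    (hU : Uᴴ * U = 1) (hW : Wᴴ * W = 1) {a : m → ℝ} {b : n → ℝ} {Y : Matrix m n ℂ} (f : ℝ → ℝ)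
    (h : spectralMatrix U a * Y = Y * spectralMatrix W b) :
    spectralMatrix U (fun i => f (a i)) * Y = Y * spectralMatrix W (fun i => f (b i)) := by
  have hU' : U * Uᴴ = 1 := mul_eq_one_comm.mp hU
  have hW' : W * Wᴴ = 1 := mul_eq_one_comm.mp hW
  unfold spectralMatrix at *
  have key : diagonal (fun i => (a i : ℂ)) * (Uᴴ * Y * W)
      = (Uᴴ * Y * W) * diagonal (fun i => (b i : ℂ)) := by
    have := congrArg (fun M => Uᴴ * M * W) h
    simp only [Matrix.mul_assoc] at this
    rw [← Matrix.mul_assoc Uᴴ U, hU, hW, Matrix.one_mul, Matrix.mul_one] at this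
    simpa only [Matrix.mul_assoc] using this
  have key' : diagonal (fun i => (f (a i) : ℂ)) * (Uᴴ * Y * W)
      = (Uᴴ * Y * W) * diagonal (fun i => (f (b i) : ℂ)) := by
    ext i j
    have hij := congrFun (congrFun key i) j
    rw [diagonal_mul, mul_diagonal] at hij ⊢
    by_cases hz : (Uᴴ * Y * W) i j = 0
    · simp [hz]
    · have : (a i : ℂ) = b j := mul_right_cancel₀ hz (by rw [hij, mul_comm])
      rw [Complex.ofReal_injective this, mul_comm]
  have := congrArg (fun M => U * M * Wᴴ) key'
  simp only [Matrix.mul_assoc] at this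
  rw [← Matrix.mul_assoc U Uᴴ, hU', hW', Matrix.one_mul, Matrix.mul_one] at this
  simpa only [Matrix.mul_assoc] using this

lemma matPow_of_isHermitian {A : Matrix n n ℂ} (hA : A.IsHermitian) (t : ℝ) :
    matPow A t = spectralMatrix (hA.eigenvectorUnitary : Matrix n n ℂ)
      (fun i => suppPow t (hA.eigenvalues i)) := by
  rw [matPow, dif_pos hA]
  rfl

lemma eq_spectralMatrix {A : Matrix n n ℂ} (hA : A.IsHermitian) :
    A = spectralMatrix (hA.eigenvectorUnitary : Matrix n n ℂ) hA.eigenvalues := by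
  conv_lhs => rw [hA.spectral_theorem]
  rfl

lemma eigenvectorUnitary_conjTranspose_mul {A : Matrix n n ℂ} (hA : A.IsHermitian) :
    (hA.eigenvectorUnitary : Matrix n n ℂ)ᴴ * (hA.eigenvectorUnitary : Matrix n n ℂ) = 1 :=
  Unitary.coe_star_mul_self hA.eigenvectorUnitary

lemma spectralMatrix_isHermitian (U : Matrix n n ℂ) (d : n → ℝ) :
    (spectralMatrix U d).IsHermitian := by
  unfold spectralMatrix
  apply isHermitian_mul_mul_conjTranspose
  rw [IsHermitian, diagonal_conjTranspose]
  congr 1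
  ext i
  simp

lemma spectralMatrix_posSemidef (U : Matrix n n ℂ) {d : n → ℝ} (hd : ∀ i, 0 ≤ d i) :
    (spectralMatrix U d).PosSemidef := by
  unfold spectralMatrix
  apply PosSemidef.mul_mul_conjTranspose_same
  apply PosSemidef.diagonal
  intro i
  simpa using hd i

lemma matPow_mul_comm {A : Matrix m m ℂ} {B : Matrix n n ℂ} (hA : A.IsHermitian)
    (hB : B.IsHermitian) {Y : Matrix m n ℂ} (h : A * Y = Y * B) (t : ℝ) :
    matPow A t * Y = Y * matPow B t := by
  rw [matPow_of_isHermitian hA, matPow_of_isHermitian hB]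
  rw [eq_spectralMatrix hA, eq_spectralMatrix hB] at h
  exact spectralMatrix_mul_comm (eigenvectorUnitary_conjTranspose_mul hA)
    (eigenvectorUnitary_conjTranspose_mul hB) (suppPow t) h

lemma matPow_spectralMatrix {U : Matrix n n ℂ} (hU : Uᴴ * U = 1) (d : n → ℝ) (t : ℝ) :
    matPow (spectralMatrix U d) t = spectralMatrix U (fun i => suppPow t (d i)) := by
  have hA := spectralMatrix_isHermitian U d
  have h := spectralMatrix_mul_comm (Y := 1) (eigenvectorUnitary_conjTranspose_mul hA) hU
    (suppPow t) (a := hA.eigenvalues) (b := d)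
    (by rw [← eq_spectralMatrix hA, Matrix.mul_one, Matrix.one_mul])
  rw [Matrix.mul_one, Matrix.one_mul] at h
  rw [matPow_of_isHermitian hA, h]

lemma exists_eq_spectralMatrix {A : Matrix n n ℂ} (hA : A.PosSemidef) :
    ∃ (U : Matrix n n ℂ) (d : n → ℝ), Uᴴ * U = 1 ∧ (∀ i, 0 ≤ d i) ∧ A = spectralMatrix U d :=
  ⟨_, _, eigenvectorUnitary_conjTranspose_mul hA.1, hA.eigenvalues_nonneg,
    eq_spectralMatrix hA.1⟩

lemma spectralMatrix_mul {U : Matrix n n ℂ} (hU : Uᴴ * U = 1) (d e : n → ℝ) :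
    spectralMatrix U d * spectralMatrix U e = spectralMatrix U (fun i => d i * e i) := by
  unfold spectralMatrix
  simp only [Matrix.mul_assoc]
  rw [← Matrix.mul_assoc Uᴴ U, hU, Matrix.one_mul, ← Matrix.mul_assoc (diagonal _) (diagonal _),
    diagonal_mul_diagonal]
  simp

lemma matPow_posSemidef {A : Matrix n n ℂ} (hA : A.PosSemidef) (t : ℝ) :
    (matPow A t).PosSemidef := by
  obtain ⟨U, d, hU, hd, rfl⟩ := exists_eq_spectralMatrix hA
  rw [matPow_spectralMatrix hU]
  exact spectralMatrix_posSemidef U fun i => suppPow_nonneg t (hd i)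

lemma matPow_conjTranspose {A : Matrix n n ℂ} (hA : A.PosSemidef) (t : ℝ) :
    (matPow A t)ᴴ = matPow A t :=
  (matPow_posSemidef hA t).1

lemma matPow_one {A : Matrix n n ℂ} (hA : A.PosSemidef) : matPow A 1 = A := by
  obtain ⟨U, d, hU, hd, rfl⟩ := exists_eq_spectralMatrix hA
  rw [matPow_spectralMatrix hU]
  simp only [suppPow_one]

lemma matPow_mul_matPow {A : Matrix n n ℂ} (hA : A.PosSemidef) (s t : ℝ) :
    matPow A s * matPow A t = matPow A (s + t) := by
  obtain ⟨U, d, hU, hd, rfl⟩ := exists_eq_spectralMatrix hA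
  simp only [matPow_spectralMatrix hU, spectralMatrix_mul hU, suppPow_mul_suppPow _ _ (hd _)]

lemma matPow_matPow {A : Matrix n n ℂ} (hA : A.PosSemidef) (s t : ℝ) :
    matPow (matPow A s) t = matPow A (s * t) := by
  obtain ⟨U, d, hU, hd, rfl⟩ := exists_eq_spectralMatrix hA
  simp only [matPow_spectralMatrix hU, suppPow_suppPow _ _ (hd _)]

lemma matPow_zero {A : Matrix n n ℂ} (hA : A.PosDef) : matPow A 0 = 1 := by
  have h : A * matPow A 0 = A * 1 := by
    conv_lhs => rw [← matPow_one hA.posSemidef]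
    rw [matPow_matPow hA.posSemidef, matPow_mul_matPow hA.posSemidef]
    simp [matPow_one hA.posSemidef]
  exact hA.isUnit.mul_left_cancel h

lemma matPow_posDef {A : Matrix n n ℂ} (hA : A.PosDef) (t : ℝ) : (matPow A t).PosDef := by
  rw [(matPow_posSemidef hA.posSemidef t).posDef_iff_isUnit]
  refine IsUnit.of_mul_eq_one (matPow A (-t)) ?_
  rw [matPow_mul_matPow hA.posSemidef, add_neg_cancel, matPow_zero hA]

lemma matPow_one_left (t : ℝ) : matPow (1 : Matrix n n ℂ) t = 1 := by
  have h : (1 : Matrix n n ℂ) = spectralMatrix 1 (fun _ => 1) := by simp [spectralMatrix]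
  rw [h, matPow_spectralMatrix (by simp)]
  simp [suppPow]

lemma matPow_kronecker {A : Matrix m m ℂ} {B : Matrix n n ℂ} (hA : A.PosSemidef)
    (hB : B.PosSemidef) (t : ℝ) : matPow (A ⊗ₖ B) t = matPow A t ⊗ₖ matPow B t := by
  obtain ⟨U, d, hU, hd, rfl⟩ := exists_eq_spectralMatrix hA
  obtain ⟨W, e, hW, he, rfl⟩ := exists_eq_spectralMatrix hB
  have h (d : m → ℝ) (e : n → ℝ) : spectralMatrix U d ⊗ₖ spectralMatrix W e
      = spectralMatrix (U ⊗ₖ W) (fun i => d i.1 * e i.2) := by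
    simp [spectralMatrix, mul_kronecker_mul, diagonal_kronecker_diagonal, conjTranspose_kronecker]
  have hUW : (U ⊗ₖ W)ᴴ * (U ⊗ₖ W) = 1 := by
    rw [conjTranspose_kronecker, ← mul_kronecker_mul, hU, hW, one_kronecker_one]
  rw [h, matPow_spectralMatrix hUW, matPow_spectralMatrix hU, matPow_spectralMatrix hW, h]
  simp only [suppPow_mul t (hd _) (he _)]

open scoped Matrix.Norms.L2Operator in
/-- The **Löwner–Heinz inequality** for `matPow`. -/
lemma matPow_le_matPow {A B : Matrix n n ℂ} (hA : A.PosSemidef) (hAB : A ≤ B) {t : ℝ}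
    (ht₀ : 0 < t) (ht₁ : t ≤ 1) : matPow A t ≤ matPow B t := by
  have h {C : Matrix n n ℂ} (hC : C.PosSemidef) : matPow C t = CFC.rpow C t := by
    change _ = C ^ t
    rw [CFC.rpow_eq_cfc_real hC.nonneg, hC.1.cfc_eq, matPow_of_isHermitian hC.1]
    have : (fun x : ℝ => x ^ t) = suppPow t := by
      ext x
      unfold suppPow
      split_ifs with hx
      · rw [hx, Real.zero_rpow ht₀.ne']
      · rfl
    rw [this]
    rfl
  have hB : B.PosSemidef := nonneg_iff_posSemidef.mp (hA.nonneg.trans hAB)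
  rw [h hA, h hB]
  exact CFC.rpow_le_rpow ⟨ht₀.le, ht₁⟩ hAB

lemma mul_conjTranspose_le_one {V : Matrix m n ℂ} (hV : Vᴴ * V ≤ 1) : V * Vᴴ ≤ 1 := by
  let : Invertible (1 : Matrix m m ℂ) := invertibleOne
  let : Invertible (1 : Matrix n n ℂ) := invertibleOne
  rw [Matrix.le_iff] at hV ⊢
  have h₁ := PosDef.fromBlocks₁₁ (A := (1 : Matrix m m ℂ)) V (1 : Matrix n n ℂ) PosDef.one
  have h₂ := PosDef.fromBlocks₂₂ (1 : Matrix m m ℂ) V (D := (1 : Matrix n n ℂ)) PosDef.one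
  simp only [inv_one, Matrix.mul_one] at h₁ h₂
  exact h₂.mp (h₁.mpr hV)

lemma matPow_half_mul_self {A : Matrix n n ℂ} (hA : A.PosSemidef) :
    matPow A (1 / 2) * matPow A (1 / 2) = A := by
  rw [matPow_mul_matPow hA, add_halves, matPow_one hA]

/-- The operator Jensen inequality for the operator convex powers. -/
lemma matPow_conjugate_le {X : Matrix m m ℂ} (hX : X.PosSemidef) {V : Matrix m n ℂ}
    (hV : Vᴴ * V ≤ 1) {α : ℝ} (hα₁ : 1 ≤ α) (hα₂ : α ≤ 2) :
    matPow (Vᴴ * X * V) α ≤ Vᴴ * matPow X α * V := by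
  rcases hα₁.eq_or_lt with rfl | hα
  · rw [matPow_one hX, matPow_one (hX.conjTranspose_mul_mul_same V)]
  obtain ⟨Y, hY⟩ : ∃ Y, Y = matPow X (1 / 2) * V := ⟨_, rfl⟩
  have hYY : Vᴴ * X * V = Yᴴ * Y := by
    rw [hY, conjTranspose_mul, matPow_conjTranspose hX]
    conv_lhs => rw [← matPow_half_mul_self hX]
    simp only [Matrix.mul_assoc]
  have hle : Y * Yᴴ ≤ X := by
    have := conjugate_le_conjugate (mul_conjTranspose_le_one hV) (matPow X (1 / 2))
    rw [Matrix.mul_one, matPow_conjTranspose hX, matPow_half_mul_self hX] at this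
    rwa [hY, conjTranspose_mul, matPow_conjTranspose hX, ← Matrix.mul_assoc,
      Matrix.mul_assoc (matPow X (1 / 2)) V]
  have hP := posSemidef_conjTranspose_mul_self Y
  have hQ := posSemidef_self_mul_conjTranspose Y
  have hcomm : matPow (Y * Yᴴ) (α - 1) * Y = Y * matPow (Yᴴ * Y) (α - 1) :=
    matPow_mul_comm hQ.1 hP.1 (Matrix.mul_assoc _ _ _) _
  have hl : matPow (Vᴴ * X * V) α = Yᴴ * matPow (Y * Yᴴ) (α - 1) * Y := by
    rw [hYY, Matrix.mul_assoc, hcomm, ← Matrix.mul_assoc]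
    conv_rhs => enter [1]; rw [← matPow_one hP]
    rw [matPow_mul_matPow hP]
    ring_nf
  have hr : Vᴴ * matPow X α * V = Yᴴ * matPow X (α - 1) * Y := by
    have : matPow X α = matPow X (1 / 2) * matPow X (α - 1) * matPow X (1 / 2) := by
      rw [matPow_mul_matPow hX, matPow_mul_matPow hX]
      ring_nf
    rw [this, hY, conjTranspose_mul, matPow_conjTranspose hX]
    simp only [Matrix.mul_assoc]
  rw [hl, hr]
  exact conjugate_le_conjugate (matPow_le_matPow hQ hle (by linarith) (by linarith)) Y

/-- The operator Jensen inequality for the operator concave powers `p ∈ [1/2, 1]`. -/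
lemma le_matPow_conjugate {X : Matrix m m ℂ} (hX : X.PosSemidef) {V : Matrix m n ℂ}
    (hV : Vᴴ * V ≤ 1) {p : ℝ} (hp₁ : 1 / 2 ≤ p) (hp₂ : p ≤ 1) :
    Vᴴ * matPow X p * V ≤ matPow (Vᴴ * X * V) p := by
  have hp : 0 < p := by linarith
  have hZ := matPow_posSemidef hX p
  have hVZ := hZ.conjTranspose_mul_mul_same V
  have h := matPow_conjugate_le hZ hV (α := p⁻¹) ((one_le_inv₀ hp).mpr hp₂)
    ((inv_le_comm₀ hp two_pos).mpr (by linarith))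
  rw [matPow_matPow hX, mul_inv_cancel₀ hp.ne', matPow_one hX] at h
  have h' := matPow_le_matPow (matPow_posSemidef hVZ p⁻¹) h hp hp₂
  rwa [matPow_matPow hVZ, inv_mul_cancel₀ hp.ne', matPow_one hVZ] at h'

/-- The perspective `S^(1/2) (S^(-1/2) L S^(-1/2))^t S^(1/2)` of the power `t`. -/
noncomputable def powPerspective (t : ℝ) (L S : Matrix n n ℂ) : Matrix n n ℂ :=
  matPow S (1 / 2) * matPow (matPow S (-(1 / 2)) * L * matPow S (-(1 / 2))) t * matPow S (1 / 2)

lemma matPow_half_mul_neg_half {S : Matrix n n ℂ} (hS : S.PosDef) :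
    matPow S (1 / 2) * matPow S (-(1 / 2)) = 1 := by
  rw [matPow_mul_matPow hS.posSemidef, add_neg_cancel, matPow_zero hS]

lemma matPow_neg_half_mul_half {S : Matrix n n ℂ} (hS : S.PosDef) :
    matPow S (-(1 / 2)) * matPow S (1 / 2) = 1 := by
  rw [matPow_mul_matPow hS.posSemidef, neg_add_cancel, matPow_zero hS]

lemma matPow_half_conjugate {S : Matrix n n ℂ} (hS : S.PosDef) (M : Matrix n n ℂ) :
    matPow S (1 / 2) * (matPow S (-(1 / 2)) * M * matPow S (-(1 / 2))) * matPow S (1 / 2) = M := by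
  simp only [Matrix.mul_assoc]
  rw [matPow_neg_half_mul_half hS, ← Matrix.mul_assoc, matPow_half_mul_neg_half hS,
    Matrix.one_mul, Matrix.mul_one]

lemma matPow_neg_half_conjugate_posSemidef {L S : Matrix n n ℂ} (hL : L.PosSemidef)
    (hS : S.PosSemidef) : (matPow S (-(1 / 2)) * L * matPow S (-(1 / 2))).PosSemidef := by
  have := hL.conjTranspose_mul_mul_same (matPow S (-(1 / 2)))
  rwa [matPow_conjTranspose hS] at this

lemma powPerspective_one {L S : Matrix n n ℂ} (hL : L.PosSemidef) (hS : S.PosDef) :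
    powPerspective 1 L S = L := by
  rw [powPerspective, matPow_one (matPow_neg_half_conjugate_posSemidef hL hS.posSemidef),
    matPow_half_conjugate hS]

lemma fromBlocks_diagonal_posSemidef {A : Matrix m m ℂ} {B : Matrix n n ℂ} (hA : A.PosSemidef)
    (hB : B.PosSemidef) : (fromBlocks A 0 0 B).PosSemidef := by
  have h₁ := hA.conjTranspose_mul_mul_same (fromCols (1 : Matrix m m ℂ) (0 : Matrix m n ℂ))
  have h₂ := hB.conjTranspose_mul_mul_same (fromCols (0 : Matrix n m ℂ) (1 : Matrix n n ℂ))
  convert h₁.add h₂ using 1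
  ext (i | i) (j | j) <;>
    simp [conjTranspose_fromCols_eq_fromRows_conjTranspose, fromRows_mul]

lemma matPow_fromBlocks {A : Matrix m m ℂ} {B : Matrix n n ℂ} (hA : A.PosSemidef)
    (hB : B.PosSemidef) (t : ℝ) :
    matPow (fromBlocks A 0 0 B) t = fromBlocks (matPow A t) 0 0 (matPow B t) := by
  obtain ⟨U, d, hU, hd, rfl⟩ := exists_eq_spectralMatrix hA
  obtain ⟨W, e, hW, he, rfl⟩ := exists_eq_spectralMatrix hB
  have h (d : m → ℝ) (e : n → ℝ) : fromBlocks (spectralMatrix U d) 0 0 (spectralMatrix W e)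
      = spectralMatrix (fromBlocks U 0 0 W) (Sum.elim d e) := by
    have hdiag : diagonal (fun i => ((Sum.elim d e i : ℝ) : ℂ))
        = fromBlocks (diagonal fun i => (d i : ℂ)) 0 0 (diagonal fun i => (e i : ℂ)) := by
      rw [fromBlocks_diagonal]
      congr 1
      ext (i | i) <;> rfl
    simp only [spectralMatrix]
    rw [hdiag]
    simp only [fromBlocks_multiply, fromBlocks_conjTranspose, conjTranspose_zero,
      Matrix.mul_zero, Matrix.zero_mul, add_zero, zero_add]
  have hUW : (fromBlocks U 0 0 W)ᴴ * fromBlocks U 0 0 W = 1 := by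
    simp [fromBlocks_conjTranspose, fromBlocks_multiply, hU, hW]
  rw [h, matPow_spectralMatrix hUW, matPow_spectralMatrix hU, matPow_spectralMatrix hW, h]
  congr 1
  ext (i | i) <;> rfl

lemma exists_contraction_powPerspective {r₁ r₂ : ℝ} (hr₁ : 0 ≤ r₁) (hr₂ : 0 ≤ r₂)
    {L₁ L₂ S₁ S₂ S : Matrix n n ℂ} (hL₁ : L₁.PosSemidef) (hL₂ : L₂.PosSemidef)
    (hS₁ : S₁.PosDef) (hS₂ : S₂.PosDef) (hS : S.PosDef)
    (hle : (r₁ : ℂ) • S₁ + (r₂ : ℂ) • S₂ ≤ S) :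
    ∃ (X : Matrix (n ⊕ n) (n ⊕ n) ℂ) (V : Matrix (n ⊕ n) n ℂ), X.PosSemidef ∧ Vᴴ * V ≤ 1 ∧
      ∀ t, Vᴴ * matPow X t * V = matPow S (-(1 / 2)) *
        ((r₁ : ℂ) • powPerspective t L₁ S₁ + (r₂ : ℂ) • powPerspective t L₂ S₂) *
          matPow S (-(1 / 2)) := by
  have hX₁ := matPow_neg_half_conjugate_posSemidef hL₁ hS₁.posSemidef
  have hX₂ := matPow_neg_half_conjugate_posSemidef hL₂ hS₂.posSemidef
  have hsq {r : ℝ} (hr : 0 ≤ r) : ((√r : ℝ) : ℂ) * ((√r : ℝ) : ℂ) = r := by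
    rw [← Complex.ofReal_mul, Real.mul_self_sqrt hr]
  have hadj {T : Matrix n n ℂ} (hT : T.PosDef) (r : ℝ) :
      (((√r : ℝ) : ℂ) • (matPow T (1 / 2) * matPow S (-(1 / 2))))ᴴ
        = ((√r : ℝ) : ℂ) • (matPow S (-(1 / 2)) * matPow T (1 / 2)) := by
    rw [conjTranspose_smul, conjTranspose_mul, matPow_conjTranspose hT.posSemidef,
      matPow_conjTranspose hS.posSemidef]
    simp
  have hterm {T : Matrix n n ℂ} {r : ℝ} (hr : 0 ≤ r) (M : Matrix n n ℂ) :
      ((√r : ℝ) : ℂ) • (matPow S (-(1 / 2)) * matPow T (1 / 2)) * M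
        * (((√r : ℝ) : ℂ) • (matPow T (1 / 2) * matPow S (-(1 / 2))))
      = matPow S (-(1 / 2)) * ((r : ℂ) • (matPow T (1 / 2) * M * matPow T (1 / 2)))
        * matPow S (-(1 / 2)) := by
    simp only [Matrix.smul_mul, Matrix.mul_smul, smul_smul, hsq hr, Matrix.mul_assoc]
  refine ⟨fromBlocks _ 0 0 _,
    fromRows (((√r₁ : ℝ) : ℂ) • (matPow S₁ (1 / 2) * matPow S (-(1 / 2))))
      (((√r₂ : ℝ) : ℂ) • (matPow S₂ (1 / 2) * matPow S (-(1 / 2)))),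
    fromBlocks_diagonal_posSemidef hX₁ hX₂, ?_, fun t => ?_⟩
  · rw [conjTranspose_fromRows_eq_fromCols_conjTranspose, fromCols_mul_fromRows, hadj hS₁,
      hadj hS₂]
    have h₁ := hterm (T := S₁) hr₁ 1
    have h₂ := hterm (T := S₂) hr₂ 1
    rw [Matrix.mul_one, Matrix.mul_one] at h₁ h₂
    rw [h₁, h₂, matPow_half_mul_self hS₁.posSemidef, matPow_half_mul_self hS₂.posSemidef,
      ← Matrix.add_mul, ← Matrix.mul_add]
    have := conjugate_le_conjugate hle (matPow S (-(1 / 2)))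
    rw [matPow_conjTranspose hS.posSemidef] at this
    refine this.trans_eq ?_
    conv_lhs => enter [1, 2]; rw [← matPow_one hS.posSemidef]
    rw [matPow_mul_matPow hS.posSemidef, matPow_mul_matPow hS.posSemidef]
    norm_num [matPow_zero hS]
  · rw [matPow_fromBlocks hX₁ hX₂, conjTranspose_fromRows_eq_fromCols_conjTranspose,
      fromCols_mul_fromBlocks, fromCols_mul_fromRows, hadj hS₁, hadj hS₂]
    simp only [Matrix.mul_zero, add_zero, zero_add]
    rw [hterm hr₁, hterm hr₂, ← Matrix.add_mul, ← Matrix.mul_add]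
    rfl

lemma powPerspective_convex {r₁ r₂ : ℝ} (hr₁ : 0 ≤ r₁) (hr₂ : 0 ≤ r₂)
    {L₁ L₂ S₁ S₂ S : Matrix n n ℂ} (hL₁ : L₁.PosSemidef) (hL₂ : L₂.PosSemidef)
    (hS₁ : S₁.PosDef) (hS₂ : S₂.PosDef) (hS : S.PosDef)
    (hle : (r₁ : ℂ) • S₁ + (r₂ : ℂ) • S₂ ≤ S) {α : ℝ} (hα₁ : 1 ≤ α) (hα₂ : α ≤ 2) :
    powPerspective α ((r₁ : ℂ) • L₁ + (r₂ : ℂ) • L₂) S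
      ≤ (r₁ : ℂ) • powPerspective α L₁ S₁ + (r₂ : ℂ) • powPerspective α L₂ S₂ := by
  obtain ⟨X, V, hX, hV, h⟩ :=
    exists_contraction_powPerspective hr₁ hr₂ hL₁ hL₂ hS₁ hS₂ hS hle
  have h₁ := h 1
  rw [matPow_one hX, powPerspective_one hL₁ hS₁, powPerspective_one hL₂ hS₂] at h₁
  have := conjugate_le_conjugate (matPow_conjugate_le hX hV hα₁ hα₂) (matPow S (1 / 2))
  rwa [h, h₁, matPow_conjTranspose hS.posSemidef, matPow_half_conjugate hS] at this

lemma powPerspective_concave {r₁ r₂ : ℝ} (hr₁ : 0 ≤ r₁) (hr₂ : 0 ≤ r₂)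
    {L₁ L₂ S₁ S₂ S : Matrix n n ℂ} (hL₁ : L₁.PosSemidef) (hL₂ : L₂.PosSemidef)
    (hS₁ : S₁.PosDef) (hS₂ : S₂.PosDef) (hS : S.PosDef)
    (hle : (r₁ : ℂ) • S₁ + (r₂ : ℂ) • S₂ ≤ S) {p : ℝ} (hp₁ : 1 / 2 ≤ p) (hp₂ : p ≤ 1) :
    (r₁ : ℂ) • powPerspective p L₁ S₁ + (r₂ : ℂ) • powPerspective p L₂ S₂
      ≤ powPerspective p ((r₁ : ℂ) • L₁ + (r₂ : ℂ) • L₂) S := by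
  obtain ⟨X, V, hX, hV, h⟩ :=
    exists_contraction_powPerspective hr₁ hr₂ hL₁ hL₂ hS₁ hS₂ hS hle
  have h₁ := h 1
  rw [matPow_one hX, powPerspective_one hL₁ hS₁, powPerspective_one hL₂ hS₂] at h₁
  have := conjugate_le_conjugate (le_matPow_conjugate hX hV hp₁ hp₂) (matPow S (1 / 2))
  rwa [h, h₁, matPow_conjTranspose hS.posSemidef, matPow_half_conjugate hS] at this

lemma powPerspective_kronecker_one_left {A : Matrix m m ℂ} {B : Matrix n n ℂ}
    (hA : A.PosDef) (hB : B.PosDef) (p : ℝ) :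
    powPerspective p (A ⊗ₖ (1 : Matrix n n ℂ)) ((1 : Matrix m m ℂ) ⊗ₖ B)
      = matPow A p ⊗ₖ matPow B (1 - p) := by
  have hB' := hB.posSemidef
  simp only [powPerspective, matPow_kronecker PosSemidef.one hB', matPow_one_left,
    ← mul_kronecker_mul, Matrix.one_mul, Matrix.mul_one, matPow_mul_matPow hB',
    matPow_kronecker hA.posSemidef (matPow_posSemidef hB' _), matPow_matPow hB']
  ring_nf

lemma powPerspective_kronecker_one_right {A : Matrix m m ℂ} {B : Matrix n n ℂ}
    (hA : A.PosDef) (hB : B.PosDef) (p : ℝ) :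
    powPerspective p ((1 : Matrix m m ℂ) ⊗ₖ B) (A ⊗ₖ (1 : Matrix n n ℂ))
      = matPow A (1 - p) ⊗ₖ matPow B p := by
  have hA' := hA.posSemidef
  simp only [powPerspective, matPow_kronecker hA' PosSemidef.one, matPow_one_left,
    ← mul_kronecker_mul, Matrix.one_mul, Matrix.mul_one, matPow_mul_matPow hA',
    matPow_kronecker (matPow_posSemidef hA' _) hB.posSemidef, matPow_matPow hA']
  ring_nf

/-- Ando's form of **Lieb's concavity theorem**. -/
lemma matPow_kronecker_matPow_concave {r₁ r₂ : ℝ} (hr₁ : 0 ≤ r₁) (hr₂ : 0 ≤ r₂)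
    {A₁ A₂ : Matrix m m ℂ} {B₁ B₂ : Matrix n n ℂ} (hA₁ : A₁.PosDef) (hA₂ : A₂.PosDef)
    (hB₁ : B₁.PosDef) (hB₂ : B₂.PosDef) (hA : ((r₁ : ℂ) • A₁ + (r₂ : ℂ) • A₂).PosDef)
    (hB : ((r₁ : ℂ) • B₁ + (r₂ : ℂ) • B₂).PosDef) {β : ℝ} (hβ₀ : 0 ≤ β) (hβ₁ : β ≤ 1) :
    (r₁ : ℂ) • (matPow A₁ β ⊗ₖ matPow B₁ (1 - β)) + (r₂ : ℂ) • (matPow A₂ β ⊗ₖ matPow B₂ (1 - β))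
      ≤ matPow ((r₁ : ℂ) • A₁ + (r₂ : ℂ) • A₂) β ⊗ₖ
        matPow ((r₁ : ℂ) • B₁ + (r₂ : ℂ) • B₂) (1 - β) := by
  have hkA : (r₁ : ℂ) • (A₁ ⊗ₖ (1 : Matrix n n ℂ)) + (r₂ : ℂ) • (A₂ ⊗ₖ (1 : Matrix n n ℂ))
      = ((r₁ : ℂ) • A₁ + (r₂ : ℂ) • A₂) ⊗ₖ (1 : Matrix n n ℂ) := by
    rw [add_kronecker, smul_kronecker, smul_kronecker]
  have hkB : (r₁ : ℂ) • ((1 : Matrix m m ℂ) ⊗ₖ B₁) + (r₂ : ℂ) • ((1 : Matrix m m ℂ) ⊗ₖ B₂)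
      = (1 : Matrix m m ℂ) ⊗ₖ ((r₁ : ℂ) • B₁ + (r₂ : ℂ) • B₂) := by
    rw [kronecker_add, kronecker_smul, kronecker_smul]
  have h1m : (1 : Matrix m m ℂ).PosDef := PosDef.one
  have h1n : (1 : Matrix n n ℂ).PosDef := PosDef.one
  rcases le_total (1 / 2) β with hβ | hβ
  · have h := powPerspective_concave hr₁ hr₂ (hA₁.kronecker h1n).posSemidef
      (hA₂.kronecker h1n).posSemidef (h1m.kronecker hB₁) (h1m.kronecker hB₂)
      (h1m.kronecker hB) hkB.le hβ hβ₁
    rwa [hkA, powPerspective_kronecker_one_left hA₁ hB₁,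
      powPerspective_kronecker_one_left hA₂ hB₂, powPerspective_kronecker_one_left hA hB] at h
  · have h := powPerspective_concave hr₁ hr₂ (h1m.kronecker hB₁).posSemidef
      (h1m.kronecker hB₂).posSemidef (hA₁.kronecker h1n) (hA₂.kronecker h1n)
      (hA.kronecker h1n) hkA.le (p := 1 - β) (by linarith) (by linarith)
    rwa [hkB, powPerspective_kronecker_one_right hA₁ hB₁,
      powPerspective_kronecker_one_right hA₂ hB₂, powPerspective_kronecker_one_right hA hB,
      sub_sub_cancel] at h

lemma Fmap_eq_powPerspective {L R : Matrix n n ℂ} (hL : L.PosSemidef) (hR : R.PosDef) (α β : ℝ) :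
    Fmap α β L R = powPerspective α (L ⊗ₖ (1 : Matrix n n ℂ))
      (matPow R β ⊗ₖ matPow Rᵀ (1 - β)) := by
  have hR' := hR.posSemidef
  have hT := hR'.transpose
  have hX : (matPow R (β * -(1 / 2)) * L * matPow R (β * -(1 / 2))).PosSemidef := by
    have := hL.conjTranspose_mul_mul_same (matPow R (β * -(1 / 2)))
    rwa [matPow_conjTranspose hR'] at this
  simp only [Fmap, powPerspective, ← mul_kronecker_mul, Matrix.mul_one,
    matPow_kronecker (matPow_posSemidef hR' _) (matPow_posSemidef hT _), matPow_matPow hR',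
    matPow_matPow hT, matPow_mul_matPow hT, matPow_kronecker hX (matPow_posSemidef hT _)]
  ring_nf

end MatPow

/-- joint operator convexity of `F` for `α ∈ [1,2]`, `β ∈ [0,1]`, on
pairs `(L, R)` with `L` positive semidefinite and `R` positive definite. -/
theorem stmt18 {n : ℕ} {α β : ℝ} (hα : α ∈ Set.Icc (1 : ℝ) 2) (hβ : β ∈ Set.Icc (0 : ℝ) 1)
    {l : ℝ} (hl : l ∈ Set.Icc (0 : ℝ) 1)
    {L₁ L₂ R₁ R₂ : Matrix (Fin n) (Fin n) ℂ}
    (hL₁ : L₁.PosSemidef) (hL₂ : L₂.PosSemidef)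
    (hR₁ : R₁.PosDef) (hR₂ : R₂.PosDef) :
    ((l : ℂ) • Fmap α β L₁ R₁ + ((1 - l : ℝ) : ℂ) • Fmap α β L₂ R₂
      - Fmap α β ((l : ℂ) • L₁ + ((1 - l : ℝ) : ℂ) • L₂)
          ((l : ℂ) • R₁ + ((1 - l : ℝ) : ℂ) • R₂)).PosSemidef := by
  have hl' : 0 ≤ 1 - l := by linarith [hl.2]
  have hc : (0 : ℂ) ≤ (l : ℂ) := Complex.zero_le_real.mpr hl.1
  have hc' : (0 : ℂ) ≤ ((1 - l : ℝ) : ℂ) := Complex.zero_le_real.mpr hl'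
  have hconv {A B : Matrix (Fin n) (Fin n) ℂ} (hA : A.PosDef) (hB : B.PosDef) :
      ((l : ℂ) • A + ((1 - l : ℝ) : ℂ) • B).PosDef := by
    rcases hl.1.eq_or_lt with rfl | hpos
    · simpa using hB
    · exact (hA.smul (Complex.zero_lt_real.mpr hpos)).add_posSemidef (hB.posSemidef.smul hc')
  have hR := hconv hR₁ hR₂
  have hRT := hconv hR₁.transpose hR₂.transpose
  have hS {R : Matrix (Fin n) (Fin n) ℂ} (h : R.PosDef) :
      (matPow R β ⊗ₖ matPow Rᵀ (1 - β)).PosDef :=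
    (matPow_posDef h _).kronecker (matPow_posDef h.transpose _)
  have hT : ((l : ℂ) • R₁ + ((1 - l : ℝ) : ℂ) • R₂)ᵀ
      = (l : ℂ) • R₁ᵀ + ((1 - l : ℝ) : ℂ) • R₂ᵀ := by
    rw [transpose_add, transpose_smul, transpose_smul]
  have hle := matPow_kronecker_matPow_concave hl.1 hl' hR₁ hR₂ hR₁.transpose hR₂.transpose
    hR hRT hβ.1 hβ.2
  rw [← hT] at hle
  have h := powPerspective_convex hl.1 hl' (hL₁.kronecker PosSemidef.one)
    (hL₂.kronecker PosSemidef.one) (hS hR₁) (hS hR₂) (hS hR) hle hα.1 hα.2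
  rw [← smul_kronecker, ← smul_kronecker, ← add_kronecker, ← Fmap_eq_powPerspective hL₁ hR₁,
    ← Fmap_eq_powPerspective hL₂ hR₂,
    ← Fmap_eq_powPerspective ((hL₁.smul hc).add (hL₂.smul hc')) hR] at h
  exact h
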